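/- Let X and Z be standard Borel spaces, let ν be a probability measure on X, and let μ and μ' be probability measures on X × Z. Suppose μ disintegrates as μ = (π_*μ) ⊗ κ for a Markov kernel κ from X to Z (π the projection to X). If KL(ν ⊗ κ ‖ μ') ≤ KL(ν ⊗ κ ‖ μ), then KL(ν ‖ π_*μ') ≤ KL(ν ‖ π_*μ). -/

import Mathlib

open MeasureTheory Classical
open scoped ENNReal

/-- The Kullback–Leibler divergence `KL(μ ‖ ν)`, valued in `[0, ∞]`.
If `μ ≪ ν` it is the integral of the nonnegative function
`klFun (dμ/dν) = (dμ/dν) log (dμ/dν) - dμ/dν + 1` against `ν` (for probability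
measures this coincides with `∫ log (dμ/dν) dμ`, infinite when that integrand
is not integrable); if `μ` is not absolutely continuous w.r.t. `ν` it is `∞`. -/
noncomputable def klDiv {X : Type*} [MeasurableSpace X] (μ ν : Measure X) : ℝ≥0∞ :=
  if μ ≪ ν then
    ∫⁻ x, ENNReal.ofReal
      ((μ.rnDeriv ν x).toReal * Real.log (μ.rnDeriv ν x).toReal
        - (μ.rnDeriv ν x).toReal + 1) ∂ν
  else ∞

open ProbabilityTheory

lemma klDiv_eq_mathlib {X : Type*} [MeasurableSpace X] (μ ν : Measure X)
    [IsFiniteMeasure μ] [IsFiniteMeasure ν] :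
    klDiv μ ν = InformationTheory.klDiv μ ν := by
  rw [InformationTheory.klDiv_eq_lintegral_klFun]
  unfold klDiv
  split_ifs
  · refine lintegral_congr fun x => ?_
    rw [InformationTheory.klFun_apply]
    congr 1
    ring
  · rfl

/-- Corollary 3.2.2 (non-increasing divergence property of the EM procedure):
if the probability measure `μ` on `X × Z` disintegrates as `μ = (π⋆μ) ⊗ κ` for a
Markov kernel `κ`, `ν` is a probability measure on `X`, and `μ'` is a probability
measure on `X × Z` with `KL(ν ⊗ κ ‖ μ') ≤ KL(ν ⊗ κ ‖ μ)`, then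
`KL(ν ‖ π⋆μ') ≤ KL(ν ‖ π⋆μ)`. -/
theorem klDiv_marginal_le_of_klDiv_joint_le {X Z : Type*}
    [MeasurableSpace X] [StandardBorelSpace X]
    [MeasurableSpace Z] [StandardBorelSpace Z]
    (ν : Measure X) [IsProbabilityMeasure ν]
    (μ μ' : Measure (X × Z)) [IsProbabilityMeasure μ] [IsProbabilityMeasure μ']
    (κ : Kernel X Z) [IsMarkovKernel κ]
    (hdis : μ = (μ.map Prod.fst).compProd κ)
    (h : klDiv (ν.compProd κ) μ' ≤ klDiv (ν.compProd κ) μ) :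
    klDiv ν (μ'.map Prod.fst) ≤ klDiv ν (μ.map Prod.fst) := by
  have : IsProbabilityMeasure (μ.map Prod.fst) :=
    Measure.isProbabilityMeasure_map measurable_fst.aemeasurable
  have : IsProbabilityMeasure (μ'.map Prod.fst) :=
    Measure.isProbabilityMeasure_map measurable_fst.aemeasurable
  rw [klDiv_eq_mathlib, klDiv_eq_mathlib] at h ⊢
  have h1 : InformationTheory.klDiv (ν.compProd κ) μ
      = InformationTheory.klDiv ν (μ.map Prod.fst) := by
    conv_lhs => rw [hdis]
    exact InformationTheory.klDiv_compProd_left _ _ _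
  have h2 : (ν.compProd κ).map Prod.fst = ν := Measure.fst_compProd ν κ
  have h3 := InformationTheory.klDiv_map_le (μ := ν.compProd κ) (ν := μ') measurable_fst
  rw [h2] at h3
  exact h3.trans (h.trans h1.le)
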